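/- arXiv:1806.04638 — 3 statements merged into one kernel-verified Lean document; each statement's English description precedes it below -/
import Mathlib

section
/- Every left ideal of a nest algebra T(N) is constructible: for any left ideal L of T(N) there exists a directed set A and a net (N_α, x_α)_{α∈A} with N_α ∈ N and x_α ∈ H such that L = {X ∈ T(N) : lim_α ‖(I − N_α) X x_α‖ = 0}. -/
noncomputable section

universe u

variable {H : Type u} [NormedAddCommGroup H] [InnerProductSpace ℂ H] [CompleteSpace H]
  [TopologicalSpace.SeparableSpace H]

/-- A nest: a linearly ordered set of orthogonal projections containing `0` and `1`. -/
structure Nest (H : Type u) [NormedAddCommGroup H] [InnerProductSpace ℂ H]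
    [CompleteSpace H] where
  carrier : Set (H →L[ℂ] H)
  isProj : ∀ P ∈ carrier, IsSelfAdjoint P ∧ P * P = P
  zero_mem : (0 : H →L[ℂ] H) ∈ carrier
  one_mem : (1 : H →L[ℂ] H) ∈ carrier
  chain : ∀ P ∈ carrier, ∀ Q ∈ carrier, Q * P = P ∨ P * Q = Q

/-- Order on projections: `P ≤ Q` iff `ran P ⊆ ran Q`. -/
def projLE (P Q : H →L[ℂ] H) : Prop := Q * P = P

/-- Strict order on projections. -/
def projLT (P Q : H →L[ℂ] H) : Prop := projLE P Q ∧ P ≠ Q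

/-- The nest algebra: all bounded operators leaving invariant the range of every
projection in the nest, i.e. `(1 - P) X P = 0` for every `P` in the nest. -/
def nestAlgebra (𝒩 : Nest H) : Subalgebra ℂ (H →L[ℂ] H) where
  carrier := {X | ∀ P ∈ 𝒩.carrier, (1 - P) * X * P = 0}
  mul_mem' := by
    intro X Y hX hY P hP
    have hX' := hX P hP
    have hY' := hY P hP
    have hYP : Y * P = P * (Y * P) := by
      have h : (1 - P) * Y * P + P * Y * P = Y * P := by noncomm_ring
      rw [hY', zero_add] at h
      rw [← mul_assoc]; exact h.symm
    calc (1 - P) * (X * Y) * P = (1 - P) * X * (Y * P) := by noncomm_ring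
      _ = (1 - P) * X * (P * (Y * P)) := by rw [← hYP]
      _ = ((1 - P) * X * P) * (Y * P) := by noncomm_ring
      _ = 0 := by rw [hX', zero_mul]
  one_mem' := by
    intro P hP
    have h := (𝒩.isProj P hP).2
    calc (1 - P) * 1 * P = P - P * P := by noncomm_ring
      _ = 0 := by rw [h, sub_self]
  add_mem' := by
    intro X Y hX hY P hP
    have hX' := hX P hP
    have hY' := hY P hP
    calc (1 - P) * (X + Y) * P = (1 - P) * X * P + (1 - P) * Y * P := by noncomm_ring
      _ = 0 := by rw [hX', hY', add_zero]
  zero_mem' := by intro P hP; simp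
  algebraMap_mem' := by
    intro c P hP
    have h := (𝒩.isProj P hP).2
    have h1 : (1 - P) * 1 * P = 0 := by
      calc (1 - P) * 1 * P = P - P * P := by noncomm_ring
        _ = 0 := by rw [h, sub_self]
    calc (1 - P) * (algebraMap ℂ (H →L[ℂ] H) c) * P
        = (1 - P) * (c • (1 : H →L[ℂ] H)) * P := by rw [Algebra.algebraMap_eq_smul_one]
      _ = c • ((1 - P) * 1 * P) := by rw [mul_smul_comm, smul_mul_assoc]
      _ = 0 := by rw [h1, smul_zero]

/-- The left ideal specified by a net `(N_α, x_α)`: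
`{X ∈ T(𝒩) : lim_α ‖(I - N_α) X x_α‖ = 0}`. -/
def constructedIdeal (𝒩 : Nest H) {A : Type u} [Preorder A]
    (Nf : A → H →L[ℂ] H) (x : A → H) : Set (H →L[ℂ] H) :=
  {X | X ∈ nestAlgebra 𝒩 ∧
    Filter.Tendsto (fun α => ‖(1 - Nf α) (X (x α))‖) Filter.atTop (nhds 0)}

/-- `L` is a left ideal of the nest algebra `T(𝒩)`. -/
def IsLeftIdealOf (𝒩 : Nest H) (L : Set (H →L[ℂ] H)) : Prop :=
  L ⊆ (nestAlgebra 𝒩 : Set (H →L[ℂ] H)) ∧ (0 : H →L[ℂ] H) ∈ L ∧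
    (∀ X ∈ L, ∀ Y ∈ L, X + Y ∈ L) ∧ (∀ c : ℂ, ∀ X ∈ L, c • X ∈ L) ∧
    (∀ T ∈ nestAlgebra 𝒩, ∀ X ∈ L, T * X ∈ L)

/-- A left ideal is constructible if it is specified by some net `(N_α, x_α)` in `𝒩 × H`. -/
def IsConstructible (𝒩 : Nest H) (L : Set (H →L[ℂ] H)) : Prop :=
  ∃ (A : Type u) (_ : Preorder A) (_ : IsDirected A (· ≤ ·)) (_ : Nonempty A)
    (Nf : A → H →L[ℂ] H) (x : A → H),
    (∀ α, Nf α ∈ 𝒩.carrier) ∧ L = constructedIdeal 𝒩 Nf x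

/-- A left ideal is strongly constructible if it is specified by some net `(N_α, x_α)`
in which every vector `x_α = (I - N_α) x_α` is a unit vector. -/
def IsStronglyConstructible (𝒩 : Nest H) (L : Set (H →L[ℂ] H)) : Prop :=
  ∃ (A : Type u) (_ : Preorder A) (_ : IsDirected A (· ≤ ·)) (_ : Nonempty A)
    (Nf : A → H →L[ℂ] H) (x : A → H),
    (∀ α, Nf α ∈ 𝒩.carrier) ∧ (∀ α, ‖x α‖ = 1) ∧ (∀ α, (1 - Nf α) (x α) = x α) ∧
    L = constructedIdeal 𝒩 Nf x

section Interpolation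

/-- Weak limits of bounded families of operators along an ultrafilter exist. -/
theorem exists_weak_limit {K G α : Type*} [NormedAddCommGroup K] [InnerProductSpace ℂ K]
    [NormedAddCommGroup G] [InnerProductSpace ℂ G] [CompleteSpace G]
    (f : Ultrafilter α) {C : ℝ} (A : α → K →L[ℂ] G)
    (hA : ∀ a k, ‖A a k‖ ≤ C * ‖k‖) :
    ∃ B : K →L[ℂ] G, ∀ k y,
      Filter.Tendsto (fun a => inner ℂ (A a k) y) f (nhds (inner ℂ (B k) y)) := by
  have hlim (k : K) : ∃ w : G, ‖w‖ ≤ C * ‖k‖ ∧ ∀ y,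
      Filter.Tendsto (fun a => inner ℂ (A a k) y) f (nhds (inner ℂ w y)) := by
    let φ : α → WeakDual ℂ G := fun a =>
      StrongDual.toWeakDual (InnerProductSpace.toDual ℂ G (A a k))
    obtain ⟨w, hw, hle⟩ := (WeakDual.isCompact_closedBall (𝕜 := ℂ) (E := G) 0
      (C * ‖k‖)).ultrafilter_le_nhds (f.map φ) (by
        rw [Ultrafilter.coe_map, Filter.le_principal_iff, Filter.mem_map]
        filter_upwards with a
        simpa [φ] using hA a k)
    refine ⟨(InnerProductSpace.toDual ℂ G).symm (WeakDual.toStrongDual w), ?_, fun y => ?_⟩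
    · simpa using hw
    · have := ((WeakDual.eval_continuous y).tendsto w).comp hle
      rw [InnerProductSpace.toDual_symm_apply]
      exact this
  choose b hb hlim using hlim
  refine ⟨LinearMap.mkContinuous ⟨⟨b, fun k l => ?_⟩, fun c k => ?_⟩ C hb, hlim⟩
  · refine ext_inner_right ℂ fun y => tendsto_nhds_unique (hlim (k + l) y) ?_
    simpa only [map_add, inner_add_left] using (hlim k y).add (hlim l y)
  · refine ext_inner_right ℂ fun y => tendsto_nhds_unique (hlim (c • k) y) ?_
    simpa only [map_smul, inner_smul_left, RingHom.id_apply] using (hlim k y).const_mul _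

variable {E K G ι : Type*} [NormedAddCommGroup E] [InnerProductSpace ℂ E]
  [NormedAddCommGroup K] [InnerProductSpace ℂ K] [CompleteSpace K]
  [NormedAddCommGroup G] [InnerProductSpace ℂ G] [CompleteSpace G]

/-- **Douglas' factorization lemma**. -/
theorem exists_contraction_comp_eq (D : E →L[ℂ] G) (V : E →L[ℂ] K)
    (h : ∀ x, ‖D x‖ ≤ ‖V x‖) :
    ∃ Z : K →L[ℂ] G, (∀ k, ‖Z k‖ ≤ ‖k‖) ∧ ∀ x, Z (V x) = D x := by
  let M : Submodule ℂ K := (LinearMap.range V.toLinearMap).topologicalClosure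
  have hM (x : E) : V x ∈ M :=
    Submodule.le_topologicalClosure _ (LinearMap.mem_range_self V.toLinearMap x)
  let e : E →ₗ[ℂ] M := V.toLinearMap.codRestrict M hM
  have he : DenseRange e := by
    rw [DenseRange, Subtype.dense_iff]
    intro y hy
    have hr : Subtype.val '' Set.range e = (LinearMap.range V.toLinearMap : Set K) := by
      ext z
      simp [e]
    exact hr ▸ hy
  have hn (x : E) : ‖D.toLinearMap x‖ ≤ 1 * ‖e x‖ := by
    simpa [e] using h x
  have : CompleteSpace M := (Submodule.isClosed_topologicalClosure _).completeSpace_coe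
  refine ⟨(D.toLinearMap.extendOfNorm e).comp M.orthogonalProjectionOnto, fun k => ?_, fun x => ?_⟩
  · refine (LinearMap.norm_extendOfNorm_apply_le he 1 hn _).trans ?_
    rw [one_mul]
    exact M.norm_orthogonalProjectionOnto_apply_le k
  · have hx : M.orthogonalProjectionOnto (V x) = e x :=
      M.orthogonalProjectionOnto_mem_subspace_eq_self (e x)
    rw [ContinuousLinearMap.comp_apply, hx]
    exact LinearMap.extendOfNorm_eq he ⟨1, hn⟩ x

/-- **Parrott's theorem**: a row `A` and a column given by `D` on the range of `V` complete to an
operator of the expected norm. -/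
theorem exists_parrott_completion {C : ℝ} (A : K →L[ℂ] G) (hA : ∀ k, ‖A k‖ ≤ C * ‖k‖)
    (D : E →L[ℂ] G) (V : E →L[ℂ] K)
    (h : ∀ x, ‖D x‖ ^ 2 + ‖A (V x)‖ ^ 2 ≤ C ^ 2 * ‖V x‖ ^ 2) :
    ∃ W : K →L[ℂ] G, (∀ k, ‖W k‖ ^ 2 + ‖A k‖ ^ 2 ≤ C ^ 2 * ‖k‖ ^ 2) ∧ ∀ x, W (V x) = D x := by
  have key (k : K) : RCLike.re (inner ℂ ((((C ^ 2 : ℝ) : ℂ) • (1 : K →L[ℂ] K)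
      - A.adjoint ∘L A) k) k) = C ^ 2 * ‖k‖ ^ 2 - ‖A k‖ ^ 2 := by
    rw [sub_apply, inner_sub_left, map_sub]
    simp only [smul_apply, one_apply_eq_self,
      ContinuousLinearMap.comp_apply, ContinuousLinearMap.adjoint_inner_left, inner_smul_left,
      Complex.conj_ofReal, inner_self_eq_norm_sq_to_K, ← RCLike.ofReal_pow]
    simp [-Complex.ofReal_pow, ← Complex.ofReal_mul]
  have hpos : 0 ≤ ((C ^ 2 : ℝ) : ℂ) • (1 : K →L[ℂ] K) - A.adjoint ∘L A := by
    rw [ContinuousLinearMap.nonneg_iff_isPositive, ContinuousLinearMap.isPositive_def']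
    refine ⟨?_, fun k => ?_⟩
    · refine IsSelfAdjoint.sub ?_ ?_
      · rw [IsSelfAdjoint, star_smul, star_one]
        simp
      · rw [ContinuousLinearMap.isSelfAdjoint_iff', ContinuousLinearMap.adjoint_comp,
          ContinuousLinearMap.adjoint_adjoint]
    · rw [ContinuousLinearMap.reApplyInnerSelf_apply, key, sub_nonneg, ← mul_pow]
      exact pow_le_pow_left₀ (norm_nonneg _) (hA k) 2
  obtain ⟨S, hS⟩ := CStarAlgebra.nonneg_iff_eq_star_mul_self.mp hpos
  have hSn (k : K) : ‖S k‖ ^ 2 = C ^ 2 * ‖k‖ ^ 2 - ‖A k‖ ^ 2 := by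
    rw [← key, hS, mul_apply_eq_comp, ContinuousLinearMap.star_eq_adjoint,
      ContinuousLinearMap.adjoint_inner_left, ← norm_sq_eq_re_inner]
  obtain ⟨Z, hZ, hZD⟩ := exists_contraction_comp_eq D (S ∘L V) fun x => by
    refine le_of_sq_le_sq ?_ (norm_nonneg _)
    rw [ContinuousLinearMap.comp_apply, hSn]
    linarith [h x]
  refine ⟨Z ∘L S, fun k => ?_, hZD⟩
  have := pow_le_pow_left₀ (norm_nonneg _) (hZ (S k)) 2
  rw [hSn] at this
  rw [ContinuousLinearMap.comp_apply]
  linarith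

/-- Interpolation along a finite chain: `S i` and `R i` play the roles of the complements of the
projections of a nest in the target and in the source. -/
theorem exists_finite_interpolation [LinearOrder ι] [OrderTop ι] [OrderBot ι]
    {C : ℝ} (hC : 0 ≤ C) (S : ι → G →L[ℂ] G) (R : ι → K →L[ℂ] K)
    (hS : ∀ i, IsSelfAdjoint (S i))
    (hSl : ∀ i j, i ≤ j → S j * S i = S j) (hSr : ∀ i j, i ≤ j → S i * S j = S j)
    (hR : ∀ i k, ‖R i k‖ ≤ ‖k‖) (hRl : ∀ i j, i ≤ j → R j * R i = R j)
    (hStop : S ⊤ = 0) (hSbot : S ⊥ = 1)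
    (X : E →L[ℂ] K) (Y : E →L[ℂ] G) (h : ∀ i x, ‖S i (Y x)‖ ≤ C * ‖R i (X x)‖) (F : Finset ι) :
    ∃ A : K →L[ℂ] G, (∀ k, ‖A k‖ ≤ C * ‖k‖) ∧ (∀ x, A (X x) = Y x) ∧
      ∀ j ∈ F, ∀ k, S j (A k) = S j (A (R j k)) := by
  have hSl' (i j) (hij : i ≤ j) (y : G) : S j (S i y) = S j y := congr($(hSl i j hij) y)
  have hSr' (i j) (hij : i ≤ j) (y : G) : S i (S j y) = S j y := congr($(hSr i j hij) y)
  have hRl' (i j) (hij : i ≤ j) (y : K) : R j (R i y) = R j y := congr($(hRl i j hij) y)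
  have pyth (a i) (hai : a ≤ i) (u v : G) : ‖S i u + (S a v - S i v)‖ ^ 2 =
      ‖S a v - S i v‖ ^ 2 + ‖S i u‖ ^ 2 := by
    have h0 : inner ℂ (S i u) (S a v - S i v) = 0 := by
      have hsym : inner ℂ (S i u) (S a v - S i v) = inner ℂ u (S i (S a v - S i v)) :=
        (ContinuousLinearMap.isSelfAdjoint_iff_isSymmetric.mp (hS i)) u _
      rw [hsym, map_sub, hSl' a i hai, hSl' i i le_rfl, sub_self, inner_zero_right]
    have := norm_add_sq_eq_norm_sq_add_norm_sq_of_inner_eq_zero _ _ h0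
    nlinarith
  have main (F : Finset ι) : ∃ i, (∀ a, (∀ j ∈ F, a < j) → a ≤ i) ∧ (∀ j ∈ F, i ≤ j) ∧
      ∃ A : K →L[ℂ] G, (∀ k, ‖A k‖ ≤ C * ‖k‖) ∧ (∀ k, A (R i k) = A k) ∧
        (∀ k, S i (A k) = A k) ∧ (∀ x, A (X x) = S i (Y x)) ∧
        ∀ j ∈ F, ∀ k, S j (A k) = S j (A (R j k)) := by
    induction F using Finset.induction_on_min with
    | empty =>
      refine ⟨⊤, fun a _ => le_top, by simp, 0, fun k => ?_, by simp [hStop]⟩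
      simpa using mul_nonneg hC (norm_nonneg k)
    | insert a F ha ih =>
      obtain ⟨i, hi, hiF, A, hA, hAR, hSA, hAX, hAF⟩ := ih
      have hai : a ≤ i := hi a ha
      have hARa (k : K) : A (R a k) = A k := by rw [← hAR, hRl' a i hai, hAR]
      obtain ⟨W, hW, hWV⟩ := exists_parrott_completion A hA (S a ∘L Y - S i ∘L Y) (R a ∘L X)
        fun x => by
          have := pow_le_pow_left₀ (norm_nonneg _) (h a x) 2
          have h1 := pyth a i hai (Y x) (Y x)
          rw [add_sub_cancel] at h1
          simp only [sub_apply, ContinuousLinearMap.comp_apply]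
          rw [hARa, hAX, ← h1, ← mul_pow]
          exact this
      have hWV' (x : E) : W (R a (X x)) = S a (Y x) - S i (Y x) := hWV x
      refine ⟨a, fun b hb => (hb a (Finset.mem_insert_self _ _)).le, ?_,
        A + (S a - S i) ∘L W ∘L R a, fun k => ?_, fun k => ?_, fun k => ?_, fun x => ?_, ?_⟩
      · intro j hj
        rcases Finset.mem_insert.mp hj with rfl | hj
        exacts [le_rfl, (ha j hj).le]
      · refine le_of_sq_le_sq ?_ (by positivity)
        have h1 := pyth a i hai (A k) (W (R a k))
        have h2 := pyth a i hai (W (R a k)) (W (R a k))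
        have h3 := pyth ⊥ a bot_le (W (R a k)) (W (R a k))
        have h4 := hW (R a k)
        have h5 := pow_le_pow_left₀ (norm_nonneg _) (hR a k) 2
        rw [hSA] at h1
        rw [add_sub_cancel] at h2 h3
        rw [hSbot, one_apply_eq_self] at h3
        rw [hARa] at h4
        have h6 : ‖(A + (S a - S i) ∘L W ∘L R a) k‖ ^ 2 =
            ‖S a (W (R a k)) - S i (W (R a k))‖ ^ 2 + ‖A k‖ ^ 2 := h1
        rw [h6, mul_pow]
        nlinarith [sq_nonneg C, sq_nonneg ‖S i (W (R a k))‖,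
          sq_nonneg ‖W (R a k) - S a (W (R a k))‖, mul_le_mul_of_nonneg_left h5 (sq_nonneg C)]
      · simp [hARa, hRl' a a le_rfl]
      · have : S a (A k) = A k := by rw [← hSA, hSr' a i hai]
        simp [this, hSr' a a le_rfl, hSr' a i hai]
      · simp [hAX, hWV', hSl' a i hai, hSl' i i le_rfl, hSr' a a le_rfl, hSr' a i hai]
      · intro j hj k
        rcases Finset.mem_insert.mp hj with rfl | hj
        · simp [hARa, hRl' j j le_rfl]
        · have hij := hiF j hj
          simp [hSl' a j (hai.trans hij), hSl' i j hij, ← hAF j hj]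
  obtain ⟨i, -, hi, A, hA, -, -, hAX, hAF⟩ := main (insert ⊥ F)
  obtain rfl : i = ⊥ := le_bot_iff.mp (hi ⊥ (Finset.mem_insert_self _ _))
  refine ⟨A, hA, fun x => by rw [hAX, hSbot, one_apply_eq_self], fun j hj =>
    hAF j (Finset.mem_insert_of_mem hj)⟩

/-- The interpolation theorem along a whole chain. -/
theorem exists_interpolation [LinearOrder ι] [OrderTop ι] [OrderBot ι]
    {C : ℝ} (hC : 0 ≤ C) (S : ι → G →L[ℂ] G) (R : ι → K →L[ℂ] K)
    (hS : ∀ i, IsSelfAdjoint (S i))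
    (hSl : ∀ i j, i ≤ j → S j * S i = S j) (hSr : ∀ i j, i ≤ j → S i * S j = S j)
    (hR : ∀ i k, ‖R i k‖ ≤ ‖k‖) (hRl : ∀ i j, i ≤ j → R j * R i = R j)
    (hStop : S ⊤ = 0) (hSbot : S ⊥ = 1)
    (X : E →L[ℂ] K) (Y : E →L[ℂ] G) (h : ∀ i x, ‖S i (Y x)‖ ≤ C * ‖R i (X x)‖) :
    ∃ A : K →L[ℂ] G, (∀ x, A (X x) = Y x) ∧ ∀ j k, S j (A k) = S j (A (R j k)) := by
  choose A hA hAX hAF using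
    exists_finite_interpolation hC S R hS hSl hSr hR hRl hStop hSbot X Y h
  let f : Ultrafilter (Finset ι) := Ultrafilter.of Filter.atTop
  have hf : (f : Filter (Finset ι)) ≤ Filter.atTop := Ultrafilter.of_le _
  obtain ⟨B, hB⟩ := exists_weak_limit f A hA
  refine ⟨B, fun x => ext_inner_right ℂ fun y => ?_, fun j k => ext_inner_right ℂ fun y => ?_⟩
  · refine tendsto_nhds_unique (hB (X x) y) ?_
    simp only [hAX]
    exact tendsto_const_nhds
  · have hsym (u : G) : inner ℂ (S j u) y = inner ℂ u (S j y) :=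
      (ContinuousLinearMap.isSelfAdjoint_iff_isSymmetric.mp (hS j)) u y
    rw [hsym, hsym]
    refine tendsto_nhds_unique (hB k (S j y)) ((hB (R j k) (S j y)).congr' ?_)
    filter_upwards [hf (Filter.eventually_ge_atTop {j})] with F hF
    rw [← hsym, ← hsym, hAF F j (hF (Finset.mem_singleton_self j)) k]

end Interpolation

namespace Nest

variable {V : Type*} [NormedAddCommGroup V] [InnerProductSpace ℂ V] [CompleteSpace V]
  (𝒩 : Nest V)

/-- The type of projections of a nest. -/
def Proj : Type _ := {P : V →L[ℂ] V // P ∈ 𝒩.carrier}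

/-- The projections of a nest are ordered by inclusion of their ranges. -/
instance : LinearOrder 𝒩.Proj where
  le P Q := projLE P.1 Q.1
  le_refl P := (𝒩.isProj P.1 P.2).2
  le_trans P Q R hPQ hQR := by
    simp only [projLE] at *
    rw [← hPQ, ← mul_assoc, hQR]
  le_antisymm P Q hPQ hQP := by
    simp only [projLE] at *
    have h := congr(star $hPQ)
    rw [star_mul, (𝒩.isProj P.1 P.2).1.star_eq, (𝒩.isProj Q.1 Q.2).1.star_eq, hQP] at h
    exact Subtype.ext h.symm
  le_total P Q := 𝒩.chain P.1 P.2 Q.1 Q.2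
  toDecidableLE := Classical.decRel _

instance : OrderTop 𝒩.Proj where
  top := ⟨1, 𝒩.one_mem⟩
  le_top P := one_mul P.1

instance : OrderBot 𝒩.Proj where
  bot := ⟨0, 𝒩.zero_mem⟩
  bot_le P := mul_zero P.1

variable {𝒩}

theorem mul_eq_left {P Q : 𝒩.Proj} (h : P ≤ Q) : Q.1 * P.1 = P.1 := h

theorem mul_eq_right {P Q : 𝒩.Proj} (h : P ≤ Q) : P.1 * Q.1 = P.1 := by
  have := congr(star $(mul_eq_left h))
  rwa [star_mul, (𝒩.isProj P.1 P.2).1.star_eq, (𝒩.isProj Q.1 Q.2).1.star_eq] at this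

theorem norm_compl_apply_le (P : 𝒩.Proj) (x : V) : ‖(1 - P.1) x‖ ≤ ‖x‖ := by
  have hP : IsStarProjection P.1 := ⟨(𝒩.isProj P.1 P.2).2, (𝒩.isProj P.1 P.2).1⟩
  exact (ContinuousLinearMap.le_of_opNorm_le _ hP.one_sub.norm_le x).trans_eq (one_mul _)

/-- The sufficiency half of the **Katsoulis–Moore–Trent interpolation theorem**. -/
theorem exists_interpolation {m : Type*} [Fintype m] {C : ℝ} (hC : 0 ≤ C)
    (X : m → V →L[ℂ] V) (Y : V →L[ℂ] V)
    (h : ∀ P ∈ 𝒩.carrier, ∀ x, ‖(1 - P) (Y x)‖ ^ 2 ≤ C ^ 2 * ∑ i, ‖(1 - P) (X i x)‖ ^ 2) :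
    ∃ A : m → V →L[ℂ] V, (∀ i, A i ∈ nestAlgebra 𝒩) ∧ Y = ∑ i, A i * X i := by
  classical
  let e := PiLp.continuousLinearEquiv 2 ℂ (fun _ : m => V)
  let R (P : 𝒩.Proj) : PiLp 2 (fun _ : m => V) →L[ℂ] PiLp 2 (fun _ : m => V) :=
    e.symm.toContinuousLinearMap ∘L
      ContinuousLinearMap.pi fun i => (1 - P.1) ∘L PiLp.proj 2 (fun _ : m => V) i
  have hRi (P : 𝒩.Proj) (k) (i : m) : R P k i = (1 - P.1) (k i) := rfl
  have hl (P Q : 𝒩.Proj) (hPQ : P ≤ Q) : (1 - Q.1) * (1 - P.1) = 1 - Q.1 := by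
    rw [mul_sub, mul_one, sub_mul, one_mul, mul_eq_left hPQ, sub_self, sub_zero]
  have hr (P Q : 𝒩.Proj) (hPQ : P ≤ Q) : (1 - P.1) * (1 - Q.1) = 1 - Q.1 := by
    rw [sub_mul, one_mul, mul_sub, mul_one, mul_eq_right hPQ, sub_self, sub_zero]
  obtain ⟨A, hAX, hAR⟩ := _root_.exists_interpolation hC (fun P : 𝒩.Proj => 1 - P.1) R
    (fun P => (IsSelfAdjoint.one _).sub (𝒩.isProj P.1 P.2).1) hl hr
    (fun P k => by
      refine le_of_sq_le_sq ?_ (norm_nonneg _)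
      rw [PiLp.norm_sq_eq_of_L2, PiLp.norm_sq_eq_of_L2]
      refine Finset.sum_le_sum fun i _ => ?_
      rw [hRi]
      exact pow_le_pow_left₀ (norm_nonneg _) (norm_compl_apply_le P _) 2)
    (fun P Q hPQ => by
      ext k i
      rw [mul_apply_eq_comp, hRi, hRi, hRi]
      exact congr($(hl P Q hPQ) (k i)))
    (sub_self _) (sub_zero _) (e.symm.toContinuousLinearMap ∘L ContinuousLinearMap.pi X) Y
    (fun P x => by
      refine le_of_sq_le_sq ?_ (by positivity)
      rw [mul_pow, PiLp.norm_sq_eq_of_L2]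
      exact h P.1 P.2 x)
  refine ⟨fun i => A ∘L e.symm.toContinuousLinearMap ∘L
    ContinuousLinearMap.single ℂ (fun _ : m => V) i, fun i P hP => ?_, ?_⟩
  · ext x
    have h0 : R ⟨P, hP⟩ (e.symm (Pi.single i (P x))) = 0 := by
      ext j
      change (1 - P) ((Pi.single i (P x) : m → V) j) = 0
      have hPP : P (P x) = P x := congr($((𝒩.isProj P hP).2) x)
      by_cases hj : j = i
      · subst hj
        simp [hPP]
      · simp [hj]
    have := hAR ⟨P, hP⟩ (e.symm (Pi.single i (P x)))
    rw [h0, map_zero, map_zero] at this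
    exact this
  · ext x
    rw [← hAX x]
    have hx : (fun i => X i x) = ∑ i, Pi.single i (X i x) :=
      (Finset.univ_sum_single fun i => X i x).symm
    change A (e.symm fun i => X i x) = _
    rw [hx, map_sum, map_sum]
    simp

end Nest

theorem IsLeftIdealOf.sum_mul_mem {V : Type*} [NormedAddCommGroup V] [InnerProductSpace ℂ V]
    [CompleteSpace V] {𝒩 : Nest V} {L : Set (V →L[ℂ] V)} (hL : IsLeftIdealOf 𝒩 L)
    {m : Type*} (s : Finset m) (A X : m → V →L[ℂ] V) (hA : ∀ i, A i ∈ nestAlgebra 𝒩)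
    (hX : ∀ i, X i ∈ L) : ∑ i ∈ s, A i * X i ∈ L := by
  obtain ⟨-, h0, hadd, -, hmul⟩ := hL
  exact Finset.sum_induction _ (· ∈ L) (fun a b ha hb => hadd a ha b hb) h0
    fun i _ => hmul _ (hA i) _ (hX i)

/-- An operator outside a left ideal is not dominated by finitely many elements of the ideal. -/
theorem IsLeftIdealOf.exists_separating {V : Type*} [NormedAddCommGroup V] [InnerProductSpace ℂ V]
    [CompleteSpace V] {𝒩 : Nest V} {L : Set (V →L[ℂ] V)}
    (hL : IsLeftIdealOf 𝒩 L) {Y : V →L[ℂ] V} (hY : Y ∉ L) (F : Finset L) (n : ℕ) :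
    ∃ P ∈ 𝒩.carrier, ∃ x : V, ‖(1 - P) (Y x)‖ = 1 ∧
      ∀ X ∈ F, ‖(1 - P) (X.1 x)‖ ≤ 1 / ((n : ℝ) + 1) := by
  by_contra hcon
  refine hY ?_
  have hdom : ∀ P ∈ 𝒩.carrier, ∀ x : V, ‖(1 - P) (Y x)‖ ^ 2 ≤
      ((n : ℝ) + 1) ^ 2 * ∑ X : F, ‖(1 - P) (X.1.1 x)‖ ^ 2 := by
    intro P hP x
    by_contra! hlt
    have hpos : 0 < ‖(1 - P) (Y x)‖ := by
      by_contra! hle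
      have h0 : ‖(1 - P) (Y x)‖ = 0 := le_antisymm hle (norm_nonneg _)
      rw [h0] at hlt
      have : 0 ≤ ((n : ℝ) + 1) ^ 2 * ∑ X : F, ‖(1 - P) (X.1.1 x)‖ ^ 2 := by positivity
      linarith
    have hnorm (T : V →L[ℂ] V) : ‖(1 - P) (T (((‖(1 - P) (Y x)‖⁻¹ : ℝ) : ℂ) • x))‖ =
        ‖(1 - P) (T x)‖ / ‖(1 - P) (Y x)‖ := by
      rw [map_smul, map_smul, norm_smul, Complex.norm_real, norm_inv, norm_norm,
        inv_mul_eq_div]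
    refine hcon ⟨P, hP, ((‖(1 - P) (Y x)‖⁻¹ : ℝ) : ℂ) • x, ?_, fun X hX => ?_⟩
    · rw [hnorm, div_self hpos.ne']
    · rw [hnorm, div_le_div_iff₀ hpos (by positivity), one_mul]
      refine le_of_sq_le_sq ?_ hpos.le
      rw [mul_pow, mul_comm]
      refine le_trans ?_ hlt.le
      refine mul_le_mul_of_nonneg_left ?_ (by positivity)
      exact Finset.single_le_sum (f := fun Z : F => ‖(1 - P) (Z.1.1 x)‖ ^ 2)
        (fun _ _ => by positivity) (Finset.mem_univ (⟨X, hX⟩ : F))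
  obtain ⟨A, hA, rfl⟩ := Nest.exists_interpolation (by positivity)
    (fun X : F => X.1.1) Y hdom
  exact hL.sum_mul_mem _ _ _ hA fun X => X.1.2

/-- The index set of a net specifying `L`: `target` ranges over the operators outside `L`, and
`bound` records finitely many elements of `L` together with how small they are made. -/
structure SeparationIndex {V : Type u} [NormedAddCommGroup V] [InnerProductSpace ℂ V]
    (L : Set (V →L[ℂ] V)) where
  bound : Finset L × ℕ
  target : {Y : V →L[ℂ] V // Y ∉ L}

instance {V : Type u} [NormedAddCommGroup V] [InnerProductSpace ℂ V] (L : Set (V →L[ℂ] V)) :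
    Preorder (SeparationIndex L) :=
  Preorder.lift SeparationIndex.bound

instance {V : Type u} [NormedAddCommGroup V] [InnerProductSpace ℂ V] (L : Set (V →L[ℂ] V)) :
    IsDirected (SeparationIndex L) (· ≤ ·) := by
  classical
  exact ⟨fun a b => ⟨⟨a.bound ⊔ b.bound, a.target⟩, le_sup_left (a := a.bound),
    le_sup_right (a := a.bound)⟩⟩

/-- every left ideal of a nest algebra is constructible. -/
theorem statement5 (𝒩 : Nest H) (L : Set (H →L[ℂ] H)) (hL : IsLeftIdealOf 𝒩 L) :
    IsConstructible 𝒩 L := by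
  by_cases hne : ∃ Y ∈ nestAlgebra 𝒩, Y ∉ L
  · obtain ⟨Y₀, hY₀, hY₀L⟩ := hne
    choose P hP x hxY hxF using fun (Y : {Y // Y ∉ L}) (F : Finset L) (n : ℕ) =>
      hL.exists_separating Y.2 F n
    have hne : Nonempty (SeparationIndex L) := ⟨⟨(∅, 0), ⟨Y₀, hY₀L⟩⟩⟩
    refine ⟨SeparationIndex L, inferInstanceAs (Preorder (SeparationIndex L)), inferInstance, hne,
      fun a => P a.target a.bound.1 a.bound.2, fun a => x a.target a.bound.1 a.bound.2,
      fun a => hP _ _ _, Set.Subset.antisymm (fun X hX => ⟨hL.1 hX, ?_⟩) fun X hX => ?_⟩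
    · refine Metric.tendsto_nhds.mpr fun ε hε => ?_
      obtain ⟨n, hn⟩ := exists_nat_one_div_lt hε
      filter_upwards [Filter.eventually_ge_atTop ⟨({⟨X, hX⟩}, n), ⟨Y₀, hY₀L⟩⟩] with a ha
      obtain ⟨ha1, ha2⟩ : {⟨X, hX⟩} ≤ a.bound.1 ∧ n ≤ a.bound.2 := ha
      rw [Real.dist_eq, sub_zero, abs_norm]
      refine (hxF a.target a.bound.1 a.bound.2 ⟨X, hX⟩ (ha1 (Finset.mem_singleton_self _))).trans_lt
        (lt_of_le_of_lt ?_ hn)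
      exact one_div_le_one_div_of_le (by positivity) (by gcongr)
    · by_contra hXL
      obtain ⟨a, ha⟩ := Filter.eventually_atTop.mp (Metric.tendsto_nhds.mp hX.2 1 one_pos)
      have := ha ⟨a.bound, ⟨X, hXL⟩⟩ (le_refl a.bound)
      rw [Real.dist_eq, sub_zero, abs_norm] at this
      exact this.ne (hxY ⟨X, hXL⟩ a.bound.1 a.bound.2)
  · push Not at hne
    refine ⟨PUnit, inferInstance, inferInstance, inferInstance, fun _ => 0, fun _ => 0,
      fun _ => 𝒩.zero_mem, Set.Subset.antisymm (fun X hX => ⟨hL.1 hX, ?_⟩)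
      fun X hX => hne X hX.1⟩
    simp
end
end

section
/- Let L be a maximal left ideal of a nest algebra T(N) and let (P_n)_{n∈ℕ} be a sequence of pairwise orthogonal projections with P_n ∈ L for all n. Then there exists a subsequence (P_{n_k}) such that the projection Σ_{k=1}^∞ P_{n_k} (strong operator sum) belongs to L. -/
noncomputable section

universe u

variable {H : Type u} [NormedAddCommGroup H] [InnerProductSpace ℂ H] [CompleteSpace H]
  [TopologicalSpace.SeparableSpace H]

/-- `L` is a maximal (proper) left ideal of the nest algebra `T(𝒩)`. -/
def IsMaximalLeftIdealOf (𝒩 : Nest H) (L : Set (H →L[ℂ] H)) : Prop :=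
  IsLeftIdealOf 𝒩 L ∧ L ≠ (nestAlgebra 𝒩 : Set (H →L[ℂ] H)) ∧
    ∀ L', IsLeftIdealOf 𝒩 L' → L ⊆ L' →
      L' = L ∨ L' = (nestAlgebra 𝒩 : Set (H →L[ℂ] H))

/-- The binary numeral with leading digit `1` followed by the first `n` digits of `f`. The ranges
of `binaryCode f`, for `f : ℕ → Bool`, form an almost disjoint family of subsets of `ℕ`. -/
def binaryCode (f : ℕ → Bool) : ℕ → ℕ
  | 0 => 1
  | n + 1 => 2 * binaryCode f n + (f n).toNat

theorem binaryCode_pos (f : ℕ → Bool) (n : ℕ) : 0 < binaryCode f n := by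
  induction n with
  | zero => simp [binaryCode]
  | succ n ih => simp only [binaryCode]; omega

theorem binaryCode_strictMono (f : ℕ → Bool) : StrictMono (binaryCode f) := by
  refine strictMono_nat_of_lt_succ fun n => ?_
  have := binaryCode_pos f n
  simp only [binaryCode]
  omega

theorem eq_of_binaryCode_eq (f g : ℕ → Bool) (m n : ℕ) (h : binaryCode f m = binaryCode g n) :
    ∀ i < m, f i = g i := by
  induction m generalizing n with
  | zero => simp
  | succ m ih =>
    have hf := binaryCode_pos f m
    cases n with
    | zero => simp only [binaryCode] at h; omega
    | succ n =>
      have hg := binaryCode_pos g n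
      simp only [binaryCode] at h
      have h1 := Bool.toNat_lt (f m)
      have h2 := Bool.toNat_lt (g n)
      have hmn : binaryCode f m = binaryCode g n := by omega
      have hpre := ih n hmn
      have hlast : f m = g n := by
        have : (f m).toNat = (g n).toNat := by omega
        revert this; cases f m <;> cases g n <;> simp
      have hlen : m = n := by
        by_contra hne
        have key : binaryCode f m = binaryCode g m := by
          clear h h1 h2 hmn hlast ih hf hg hne
          induction m with
          | zero => rfl
          | succ k ihk =>
            simp only [binaryCode]
            rw [ihk fun i hi => hpre i (hi.trans k.lt_succ_self), hpre k k.lt_succ_self]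
        exact hne ((binaryCode_strictMono g).injective (key.symm.trans hmn))
      subst hlen
      intro i hi
      rcases Nat.lt_succ_iff_lt_or_eq.mp hi with hi | rfl
      · exact hpre i hi
      · exact hlast

/-- Finitely many members of the almost disjoint family become disjoint after deleting
sufficiently long initial segments. -/
theorem exists_binaryCode_tail_ne (s : Finset (ℕ → Bool)) :
    ∃ k, ∀ f ∈ s, ∀ g ∈ s, f ≠ g → ∀ i j, binaryCode f (i + k) ≠ binaryCode g (j + k) := by
  have h : ∀ p : (ℕ → Bool) × (ℕ → Bool), ∃ k, p.1 ≠ p.2 → p.1 k ≠ p.2 k := by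
    intro p
    by_cases hp : p.1 = p.2
    · exact ⟨0, fun h => absurd hp h⟩
    · obtain ⟨k, hk⟩ := Function.ne_iff.mp hp
      exact ⟨k, fun _ => hk⟩
  choose k hk using h
  refine ⟨(s ×ˢ s).sup k + 1, fun f hf g hg hne i j heq => hk (f, g) hne ?_⟩
  refine eq_of_binaryCode_eq f g _ _ heq _ ?_
  have : k (f, g) ≤ (s ×ˢ s).sup k := Finset.le_sup (Finset.mk_mem_product hf hg)
  omega

section OrthogonalProjections

open scoped InnerProductSpace

variable {E : Type*} [NormedAddCommGroup E] [InnerProductSpace ℂ E]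

theorem mul_eq_zero_of_hasSum_apply {ι κ : Type*} {P : ι → E →L[ℂ] E} {R : κ → E →L[ℂ] E}
    {Q S : E →L[ℂ] E} (hQ : ∀ x, HasSum (fun i => P i x) (Q x))
    (hS : ∀ x, HasSum (fun j => R j x) (S x)) (h : ∀ i j, P i * R j = 0) : Q * S = 0 := by
  ext x
  have h1 : ∀ i, P i (S x) = 0 := fun i => by
    have h2 := (hS x).mapL (P i)
    have h3 : (fun j => P i (R j x)) = fun _ => 0 :=
      funext fun j => DFunLike.congr_fun (h i j) x
    rw [h3] at h2
    exact h2.unique hasSum_zero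
  have h4 := hQ (S x)
  simp only [h1] at h4
  exact h4.unique hasSum_zero

theorem mul_self_of_hasSum_apply {ι : Type*} {P : ι → E →L[ℂ] E} {Q : E →L[ℂ] E}
    (hP : ∀ i, P i * P i = P i) (horth : ∀ i j, i ≠ j → P i * P j = 0)
    (hQ : ∀ x, HasSum (fun i => P i x) (Q x)) : Q * Q = Q := by
  ext x
  have h1 : ∀ i, P i (Q x) = P i x := fun i => by
    have h2 : HasSum (fun j => P i (P j x)) (P i (P i x)) :=
      hasSum_single i fun j hj => DFunLike.congr_fun (horth i j hj.symm) x
    have h3 : P i (P i x) = P i x := DFunLike.congr_fun (hP i) x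
    rw [h3] at h2
    exact ((hQ x).mapL (P i)).unique h2
  have h4 := hQ (Q x)
  simp only [h1] at h4
  exact h4.unique (hQ x)

variable [CompleteSpace E]

theorem inner_apply_apply_eq_zero {P Q : E →L[ℂ] E} (hP : IsSelfAdjoint P) (hPQ : P * Q = 0)
    (x y : E) : ⟪P x, Q y⟫_ℂ = 0 := by
  have h1 : ⟪P x, Q y⟫_ℂ = ⟪x, P (Q y)⟫_ℂ := hP.isSymmetric x (Q y)
  have h2 : P (Q y) = (P * Q) y := rfl
  rw [h1, h2, hPQ]
  simp

theorem norm_sum_apply_sq {ι : Type*} (s : Finset ι) (P : ι → E →L[ℂ] E)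
    (hP : ∀ i ∈ s, IsSelfAdjoint (P i))
    (horth : ∀ i ∈ s, ∀ j ∈ s, i ≠ j → P i * P j = 0) (x : E) :
    ‖∑ i ∈ s, P i x‖ ^ 2 = ∑ i ∈ s, ‖P i x‖ ^ 2 := by
  classical
  have h : ⟪∑ i ∈ s, P i x, ∑ i ∈ s, P i x⟫_ℂ = ∑ i ∈ s, ((‖P i x‖ : ℂ)) ^ 2 := by
    rw [sum_inner]
    refine Finset.sum_congr rfl fun i hi => ?_
    rw [inner_sum, Finset.sum_eq_single_of_mem i hi]
    · exact inner_self_eq_norm_sq_to_K _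
    · intro j hj hne
      exact inner_apply_apply_eq_zero (hP i hi) (horth i hi j hj hne.symm) x x
  rw [inner_self_eq_norm_sq_to_K] at h
  apply Complex.ofReal_injective
  push_cast
  exact h

/-- Bessel's inequality for pairwise orthogonal projections. -/
theorem sum_norm_apply_sq_le {ι : Type*} (s : Finset ι) (P : ι → E →L[ℂ] E)
    (hP : ∀ i ∈ s, IsSelfAdjoint (P i) ∧ P i * P i = P i)
    (horth : ∀ i ∈ s, ∀ j ∈ s, i ≠ j → P i * P j = 0) (x : E) :
    ∑ i ∈ s, ‖P i x‖ ^ 2 ≤ ‖x‖ ^ 2 := by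
  have h1 := norm_sum_apply_sq s P (fun i hi => (hP i hi).1) horth x
  have h2 : ⟪∑ i ∈ s, P i x, x⟫_ℂ = ∑ i ∈ s, ((‖P i x‖ : ℂ)) ^ 2 := by
    rw [sum_inner]
    refine Finset.sum_congr rfl fun i hi => ?_
    have h3 : P i (P i x) = P i x := DFunLike.congr_fun (hP i hi).2 x
    have h4 : ⟪P i (P i x), x⟫_ℂ = ⟪P i x, P i x⟫_ℂ := (hP i hi).1.isSymmetric (P i x) x
    rw [h3] at h4
    rw [h4]
    exact inner_self_eq_norm_sq_to_K _
  have h5 : ∑ i ∈ s, ‖P i x‖ ^ 2 ≤ ‖∑ i ∈ s, P i x‖ * ‖x‖ := by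
    have h6 := norm_inner_le_norm (𝕜 := ℂ) (∑ i ∈ s, P i x) x
    rw [h2] at h6
    have h7 : ‖∑ i ∈ s, ((‖P i x‖ : ℂ)) ^ 2‖ = ∑ i ∈ s, ‖P i x‖ ^ 2 := by
      have : ∑ i ∈ s, ((‖P i x‖ : ℂ)) ^ 2 = ((∑ i ∈ s, ‖P i x‖ ^ 2 : ℝ) : ℂ) := by push_cast; rfl
      rw [this, Complex.norm_real, Real.norm_of_nonneg (Finset.sum_nonneg fun i _ => by positivity)]
    rwa [h7] at h6
  rw [← h1] at h5 ⊢
  nlinarith [sq_nonneg (‖∑ i ∈ s, P i x‖ - ‖x‖)]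

/-- Pairwise orthogonal projections are summable in the strong operator topology. -/
theorem exists_hasSum_apply {ι : Type*} (P : ι → E →L[ℂ] E)
    (hP : ∀ i, IsSelfAdjoint (P i) ∧ P i * P i = P i)
    (horth : ∀ i j, i ≠ j → P i * P j = 0) :
    ∃ Q : E →L[ℂ] E, ∀ x, HasSum (fun i => P i x) (Q x) := by
  have hsq : ∀ x, Summable fun i => ‖P i x‖ ^ 2 := fun x =>
    summable_of_sum_le (fun i => by positivity) fun s =>
      sum_norm_apply_sq_le s P (fun i _ => hP i) (fun i _ j _ => horth i j) x
  have hnorm : ∀ s : Finset ι, ∀ x, ‖∑ i ∈ s, P i x‖ ^ 2 = ∑ i ∈ s, ‖P i x‖ ^ 2 := fun s x =>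
    norm_sum_apply_sq s P (fun i _ => (hP i).1) (fun i _ j _ => horth i j) x
  have hsum : ∀ x, Summable fun i => P i x := by
    intro x
    rw [summable_iff_vanishing_norm]
    intro ε hε
    obtain ⟨s, hs⟩ := summable_iff_vanishing_norm.mp (hsq x) (ε ^ 2) (by positivity)
    refine ⟨s, fun t ht => ?_⟩
    have h := (le_abs_self _).trans_lt (hs t ht)
    rw [← hnorm] at h
    exact lt_of_pow_lt_pow_left₀ 2 hε.le h
  let Q : E →ₗ[ℂ] E :=
    { toFun := fun x => ∑' i, P i x
      map_add' := fun x y => by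
        simp only [map_add]
        exact (hsum x).tsum_add (hsum y)
      map_smul' := fun c x => by
        simp only [map_smul, RingHom.id_apply]
        exact (hsum x).tsum_const_smul c }
  refine ⟨Q.mkContinuous 1 fun x => ?_, fun x => (hsum x).hasSum⟩
  refine le_of_tendsto (hsum x).hasSum.norm (Filter.Eventually.of_forall fun s => ?_)
  rw [one_mul]
  refine le_of_pow_le_pow_left₀ two_ne_zero (norm_nonneg x) ?_
  rw [hnorm]
  exact sum_norm_apply_sq_le s P (fun i _ => hP i) (fun i _ j _ => horth i j) x

theorem isSelfAdjoint_of_hasSum_apply {ι : Type*} {P : ι → E →L[ℂ] E} {Q : E →L[ℂ] E}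
    (hP : ∀ i, IsSelfAdjoint (P i)) (hQ : ∀ x, HasSum (fun i => P i x) (Q x)) :
    IsSelfAdjoint Q := by
  rw [ContinuousLinearMap.isSelfAdjoint_iff_isSymmetric]
  intro x y
  have h1 : HasSum (fun i => ⟪P i x, y⟫_ℂ) ⟪Q x, y⟫_ℂ := by
    have := ((hQ x).mapL (innerSL ℂ y)).map (starRingEnd ℂ) continuous_star
    simpa [Function.comp_def] using this
  have h2 : HasSum (fun i => ⟪x, P i y⟫_ℂ) ⟪x, Q y⟫_ℂ := (hQ y).mapL (innerSL ℂ x)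
  have h3 : (fun i => ⟪P i x, y⟫_ℂ) = fun i => ⟪x, P i y⟫_ℂ :=
    funext fun i => (hP i).isSymmetric x y
  rw [h3] at h1
  exact h1.unique h2

/-- A row of operators bounded by `C`, composed with orthogonal projections, has norm at most
`C` times the square root of its length. -/
theorem norm_sum_mul_sq_le {ι : Type*} (s : Finset ι) (T Q : ι → E →L[ℂ] E) {C : ℝ} (hC : 0 ≤ C)
    (hT : ∀ i ∈ s, ‖T i‖ ≤ C) (hQ : ∀ i ∈ s, IsSelfAdjoint (Q i) ∧ Q i * Q i = Q i)
    (horth : ∀ i ∈ s, ∀ j ∈ s, i ≠ j → Q i * Q j = 0) :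
    ‖∑ i ∈ s, T i * Q i‖ ≤ C * √(s.card) := by
  refine ContinuousLinearMap.opNorm_le_bound _ (by positivity) fun x => ?_
  have h1 : ‖(∑ i ∈ s, T i * Q i) x‖ ≤ C * ∑ i ∈ s, ‖Q i x‖ := by
    rw [sum_apply, Finset.mul_sum]
    refine norm_sum_le_of_le s fun i hi => ?_
    exact (T i).le_of_opNorm_le (hT i hi) (Q i x)
  have h2 : ∑ i ∈ s, ‖Q i x‖ ≤ √(s.card) * ‖x‖ := by
    refine le_of_pow_le_pow_left₀ two_ne_zero (by positivity) ?_
    rw [mul_pow, Real.sq_sqrt (by positivity)]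
    refine sq_sum_le_card_mul_sum_sq.trans ?_
    gcongr
    exact sum_norm_apply_sq_le s Q hQ horth x
  calc _ ≤ _ := h1
    _ ≤ C * (√(s.card) * ‖x‖) := by gcongr
    _ = _ := by ring

end OrthogonalProjections

section LeftIdeals

variable {E : Type*} [NormedAddCommGroup E] [InnerProductSpace ℂ E] [CompleteSpace E]

theorem isClosed_nestAlgebra (𝒩 : Nest E) : IsClosed (nestAlgebra 𝒩 : Set (E →L[ℂ] E)) := by
  have h : (nestAlgebra 𝒩 : Set (E →L[ℂ] E)) =
      ⋂ P ∈ 𝒩.carrier, {X | (1 - P) * X * P = 0} := by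
    ext X
    simp only [Set.mem_iInter]
    rfl
  rw [h]
  exact isClosed_biInter fun P _ => isClosed_eq (by fun_prop) continuous_const

theorem mem_nestAlgebra_of_hasSum_apply {𝒩 : Nest E} {ι : Type*} {P : ι → E →L[ℂ] E}
    {Q : E →L[ℂ] E} (hP : ∀ i, P i ∈ nestAlgebra 𝒩)
    (hQ : ∀ x, HasSum (fun i => P i x) (Q x)) : Q ∈ nestAlgebra 𝒩 := by
  intro N hN
  ext x
  have h := (hQ (N x)).mapL (1 - N)
  have h0 : (fun i => (1 - N) (P i (N x))) = fun _ => 0 :=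
    funext fun i => DFunLike.congr_fun (hP i N hN) x
  rw [h0] at h
  exact h.unique hasSum_zero

theorem IsLeftIdealOf.sum_mem {𝒩 : Nest E} {L : Set (E →L[ℂ] E)} (hL : IsLeftIdealOf 𝒩 L)
    {ι : Type*} (s : Finset ι) (X : ι → E →L[ℂ] E) (hX : ∀ i ∈ s, X i ∈ L) :
    ∑ i ∈ s, X i ∈ L :=
  Finset.sum_induction X (· ∈ L) (fun _ _ ha hb => hL.2.2.1 _ ha _ hb) hL.2.1 hX

/-- A proper left ideal contains no perturbation of the identity by a strict contraction. -/
theorem IsLeftIdealOf.one_sub_notMem {𝒩 : Nest E} {L : Set (E →L[ℂ] E)}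
    (hL : IsLeftIdealOf 𝒩 L) (hne : L ≠ (nestAlgebra 𝒩 : Set (E →L[ℂ] E))) {A : E →L[ℂ] E}
    (hA : A ∈ nestAlgebra 𝒩) (hnorm : ‖A‖ < 1) : 1 - A ∉ L := by
  intro hmem
  have : CompleteSpace (nestAlgebra 𝒩) := (isClosed_nestAlgebra 𝒩).completeSpace_coe
  let u := Units.oneSub (⟨A, hA⟩ : nestAlgebra 𝒩) hnorm
  have hu : ((u⁻¹ : (nestAlgebra 𝒩)ˣ) : nestAlgebra 𝒩).1 * (1 - A) = 1 :=
    congrArg Subtype.val u.inv_mul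
  have h1 : (1 : E →L[ℂ] E) ∈ L := hu ▸ hL.2.2.2.2 _ (u⁻¹ : (nestAlgebra 𝒩)ˣ).1.2 _ hmem
  refine hne (hL.1.antisymm fun X hX => ?_)
  have := hL.2.2.2.2 X hX 1 h1
  rwa [mul_one] at this

theorem IsMaximalLeftIdealOf.exists_one_sub_mul_mem {𝒩 : Nest E} {L : Set (E →L[ℂ] E)}
    (hL : IsMaximalLeftIdealOf 𝒩 L) {Q : E →L[ℂ] E} (hQ : Q ∈ nestAlgebra 𝒩) (hQL : Q ∉ L) :
    ∃ T ∈ nestAlgebra 𝒩, 1 - T * Q ∈ L := by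
  obtain ⟨⟨hsub, hzero, hadd, hsmul, hmul⟩, -, hmax⟩ := hL
  let L' : Set (E →L[ℂ] E) := {Y | ∃ T ∈ nestAlgebra 𝒩, Y - T * Q ∈ L}
  have hle : L ⊆ L' := fun X hX => ⟨0, zero_mem _, by simpa using hX⟩
  have hQL' : Q ∈ L' := ⟨1, one_mem _, by simpa using hzero⟩
  have hL' : IsLeftIdealOf 𝒩 L' := by
    refine ⟨?_, hle hzero, ?_, ?_, ?_⟩
    · rintro Y ⟨T, hT, hY⟩
      have := add_mem (hsub hY) (mul_mem hT hQ)
      rwa [sub_add_cancel] at this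
    · rintro Y ⟨T, hT, hY⟩ Z ⟨S, hS, hZ⟩
      refine ⟨T + S, add_mem hT hS, ?_⟩
      convert hadd _ hY _ hZ using 1
      noncomm_ring
    · rintro c Y ⟨T, hT, hY⟩
      refine ⟨c • T, Subalgebra.smul_mem _ hT c, ?_⟩
      convert hsmul c _ hY using 1
      rw [smul_sub, smul_mul_assoc]
    · rintro S hS Y ⟨T, hT, hY⟩
      refine ⟨S * T, mul_mem hS hT, ?_⟩
      convert hmul S hS _ hY using 1
      noncomm_ring
  rcases hmax L' hL' hle with h | h
  · exact absurd (h ▸ hQL') hQL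
  · have h1 : (1 : E →L[ℂ] E) ∈ L' := h ▸ one_mem (nestAlgebra 𝒩)
    exact h1

end LeftIdeals

/-- An uncountable family of reals is bounded above on arbitrarily large finite sets, by a
common bound. -/
theorem exists_bound_forall_exists_finset_card {ι : Type*} [Uncountable ι] (c : ι → ℝ) :
    ∃ C : ℕ, ∀ m : ℕ, ∃ s : Finset ι, s.card = m ∧ ∀ i ∈ s, c i ≤ C := by
  have h : ∃ C : ℕ, {i | c i ≤ C}.Infinite := by
    by_contra! hfin
    refine Set.not_countable_univ (α := ι) ?_
    refine (Set.countable_iUnion fun C : ℕ => (hfin C).countable).mono fun i _ => ?_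
    exact Set.mem_iUnion.mpr (exists_nat_ge (c i))
  obtain ⟨C, hC⟩ := h
  refine ⟨C, fun m => ?_⟩
  obtain ⟨s, hs, hcard⟩ := hC.exists_subset_card_eq m
  exact ⟨s, hcard, fun i hi => hs hi⟩

/-- if `L` is a maximal left ideal of `T(𝒩)` and `(P_n)` is a sequence of
pairwise orthogonal projections in `L`, then some subsequence `(P_{n_k})` has its
(strong-operator) sum `Σ_k P_{n_k}` in `L`. -/
theorem statement11 (𝒩 : Nest H) (L : Set (H →L[ℂ] H))
    (hL : IsMaximalLeftIdealOf 𝒩 L) (P : ℕ → H →L[ℂ] H)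
    (hproj : ∀ n, IsSelfAdjoint (P n) ∧ P n * P n = P n)
    (horth : ∀ m n, m ≠ n → P m * P n = 0) (hmem : ∀ n, P n ∈ L) :
    ∃ n : ℕ → ℕ, StrictMono n ∧
      ∃ Q ∈ L, ∀ h : H, HasSum (fun k => P (n k) h) (Q h) := by
  by_contra hcon
  have hP : ∀ n, P n ∈ nestAlgebra 𝒩 := fun n => hL.1.1 (hmem n)
  have hsubseq : ∀ n : ℕ → ℕ, StrictMono n → ∃ Q : H →L[ℂ] H,
      ∀ x, HasSum (fun k => P (n k) x) (Q x) := fun n hn =>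
    exists_hasSum_apply (fun k => P (n k)) (fun k => hproj _)
      fun i j hij => horth _ _ (hn.injective.ne hij)
  choose Q hQ using fun f => hsubseq _ (binaryCode_strictMono f)
  have hQN : ∀ f, Q f ∈ nestAlgebra 𝒩 := fun f =>
    mem_nestAlgebra_of_hasSum_apply (fun k => hP _) (hQ f)
  have hQL : ∀ f, Q f ∉ L := fun f hf => hcon ⟨_, binaryCode_strictMono f, Q f, hf, hQ f⟩
  choose T hT hTQ using fun f => hL.exists_one_sub_mul_mem (hQN f) (hQL f)
  have : Uncountable (ℕ → Bool) := by
    rw [← Cardinal.aleph0_lt_mk_iff]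
    simpa using Cardinal.cantor Cardinal.aleph0
  obtain ⟨C, hC⟩ := exists_bound_forall_exists_finset_card fun f => ‖T f‖
  obtain ⟨s, hcard, hbound⟩ := hC ((C + 1) ^ 2)
  obtain ⟨k, hk⟩ := exists_binaryCode_tail_ne s
  let R : (ℕ → Bool) → H →L[ℂ] H := fun f => Q f - ∑ j ∈ Finset.range k, P (binaryCode f j)
  have hR : ∀ f x, HasSum (fun j => P (binaryCode f (j + k)) x) (R f x) := by
    intro f x
    have := (hasSum_nat_add_iff' k).mpr (hQ f x)
    simpa [R, sum_apply] using this
  have hRproj : ∀ f, IsSelfAdjoint (R f) ∧ R f * R f = R f := fun f =>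
    ⟨isSelfAdjoint_of_hasSum_apply (fun j => (hproj _).1) (hR f),
      mul_self_of_hasSum_apply (fun j => (hproj _).2) (fun i j hij => horth _ _
        ((binaryCode_strictMono f).injective.ne (by omega))) (hR f)⟩
  have hRorth : ∀ f ∈ s, ∀ g ∈ s, f ≠ g → R f * R g = 0 := fun f hf g hg hne =>
    mul_eq_zero_of_hasSum_apply (hR f) (hR g) fun i j => horth _ _ (hk f hf g hg hne i j)
  have hRN : ∀ f, R f ∈ nestAlgebra 𝒩 := fun f =>
    mem_nestAlgebra_of_hasSum_apply (fun j => hP _) (hR f)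
  have hTR : ∀ f, 1 - T f * R f ∈ L := by
    intro f
    have h := hL.1.2.2.1 _ (hTQ f) _ (hL.1.2.2.2.2 _ (hT f) _
      (hL.1.sum_mem (Finset.range k) (fun j => P (binaryCode f j)) fun j _ => hmem _))
    convert h using 1
    simp only [R, mul_sub]
    abel
  have hnorm := norm_sum_mul_sq_le s T R C.cast_nonneg hbound (fun f _ => hRproj f) hRorth
  set A : H →L[ℂ] H := ∑ f ∈ s, T f * R f with hA
  have hs : (s.card : ℂ) ≠ 0 := by rw [hcard]; exact_mod_cast (by positivity : (C + 1) ^ 2 ≠ 0)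
  refine hL.1.one_sub_notMem hL.2.1 (A := (s.card : ℂ)⁻¹ • A)
    (Subalgebra.smul_mem _ (sum_mem fun f _ => mul_mem (hT f) (hRN f)) _) ?_ ?_
  · rw [norm_smul, norm_inv, Complex.norm_natCast]
    rw [hcard] at hnorm ⊢
    push_cast at hnorm ⊢
    rw [Real.sqrt_sq (by positivity)] at hnorm
    rw [inv_mul_lt_iff₀ (by positivity)]
    nlinarith [(C.cast_nonneg : (0 : ℝ) ≤ C)]
  · have h := hL.1.2.2.2.1 (s.card : ℂ)⁻¹ _ (hL.1.sum_mem s _ fun f _ => hTR f)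
    rw [Finset.sum_sub_distrib, Finset.sum_const, ← hA, smul_sub, ← Nat.cast_smul_eq_nsmul ℂ,
      smul_smul, inv_mul_cancel₀ hs, one_smul] at h
    exact h
end
end

section
/- Let T(ℕ) be the algebra of upper-triangular bounded operators on ℓ²(ℕ) with respect to the standard basis, and let P be a primitive ideal of T(ℕ) strictly containing the ideal K of compact upper-triangular operators. Then there is a strictly increasing sequence of integers (n_k) such that P contains the two-sided ideal {X ∈ T(ℕ) : (N_{n_k} − N_{n_{k−1}}) X (N_{n_k} − N_{n_{k−1}}) = 0 for all k}, where N_n is the projection onto the span of the first n basis vectors. -/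
noncomputable section

universe u

variable {H : Type u} [NormedAddCommGroup H] [InnerProductSpace ℂ H] [CompleteSpace H]
  [TopologicalSpace.SeparableSpace H]

/-- A (left) primitive ideal of a unital ring: the kernel of the left regular
representation on the quotient by a maximal left ideal, i.e. the largest two-sided
ideal `{x | x·R ⊆ L}` contained in a maximal left ideal `L`. -/
def IsLeftPrimitive (R : Type*) [Ring R] (P : Set R) : Prop :=
  ∃ L : Ideal R, L.IsMaximal ∧ P = {x : R | ∀ r : R, x * r ∈ L}

/-- The projection `N_n` onto the span of the first `n` vectors of an orthonormal
basis `e` of `H`. -/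
def canonicalProj (e : HilbertBasis ℕ ℂ H) (n : ℕ) : H →L[ℂ] H :=
  ∑ i ∈ Finset.range n, (innerSL ℂ (e i)).smulRight (e i)

section Helpers

open Filter Topology

variable {E : Type u} [NormedAddCommGroup E] [InnerProductSpace ℂ E]

/-- The kernel of the left regular representation modulo a maximal left ideal is prime. -/
theorem mem_or_mem_of_forall_mul_mul_mem {R : Type*} [Ring R] {L : Ideal R} (hL : L.IsMaximal)
    {x y : R} (h : ∀ t r : R, x * t * y * r ∈ L) :
    (∀ r, x * r ∈ L) ∨ ∀ r, y * r ∈ L := by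
  by_contra! hcon
  obtain ⟨⟨t, ht⟩, r, hr⟩ := hcon
  obtain ⟨s, l, hl, hs⟩ := hL.exists_inv hr
  apply ht
  have key : x * t = x * (t * s) * y * r + x * t * l := by
    calc x * t = x * t * (s * (y * r) + l) := by rw [hs, mul_one]
      _ = _ := by noncomm_ring
  rw [key]
  exact L.add_mem (h _ _) (L.mul_mem_left _ hl)

theorem HilbertBasis.eq_zero_of_inner_eq_zero (e : HilbertBasis ℕ ℂ E) {x : E}
    (h : ∀ i, inner ℂ (e i) x = 0) : x = 0 := by
  rw [← inner_self_eq_zero (𝕜 := ℂ)]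
  refine (e.hasSum_inner_mul_inner _ _).unique ?_
  convert! hasSum_zero with j
  rw [h j, mul_zero]

theorem HilbertBasis.inner_eq_ite (e : HilbertBasis ℕ ℂ E) (i j : ℕ) :
    inner ℂ (e i) (e j) = if i = j then 1 else 0 :=
  orthonormal_iff_ite.1 e.orthonormal i j

theorem inner_canonicalProj (e : HilbertBasis ℕ ℂ E) (n i : ℕ) (x : E) :
    inner ℂ (e i) (canonicalProj e n x) = if i < n then inner ℂ (e i) x else 0 := by
  simp [canonicalProj, e.inner_eq_ite]

theorem canonicalProj_apply_basis (e : HilbertBasis ℕ ℂ E) (n j : ℕ) :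
    canonicalProj e n (e j) = if j < n then e j else 0 := by
  simp [canonicalProj, e.inner_eq_ite]

theorem exists_forall_inner_eq_zero_of_mem_span (e : HilbertBasis ℕ ℂ E) {x : E}
    (hx : x ∈ Submodule.span ℂ (Set.range e)) : ∃ m, ∀ i, m ≤ i → inner ℂ (e i) x = 0 := by
  induction hx using Submodule.span_induction with
  | mem x hx =>
    obtain ⟨j, rfl⟩ := hx
    exact ⟨j + 1, fun i hi => by rw [e.inner_eq_ite, if_neg (by omega)]⟩
  | zero => exact ⟨0, by simp⟩
  | add x y _ _ hx hy =>
    obtain ⟨a, ha⟩ := hx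
    obtain ⟨b, hb⟩ := hy
    exact ⟨max a b, fun i hi => by
      rw [inner_add_right, ha i (le_of_max_le_left hi), hb i (le_of_max_le_right hi), add_zero]⟩
  | smul c x _ hx =>
    obtain ⟨a, ha⟩ := hx
    exact ⟨a, fun i hi => by rw [inner_smul_right, ha i hi, mul_zero]⟩

/-- For `F` dense and `V` finite-dimensional there is a continuous linear map which fixes `Vᗮ`
and maps `F` into `F ⊓ Vᗮ`; in particular `F ⊓ Vᗮ` is dense in `Vᗮ`. -/
theorem exists_clm_fixing_orthogonal (F V : Submodule ℂ E) [FiniteDimensional ℂ V]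
    (hF : Dense (F : Set E)) :
    ∃ R : E →L[ℂ] E, (∀ x ∈ Vᗮ, R x = x) ∧ ∀ x ∈ F, R x ∈ F ∧ R x ∈ Vᗮ := by
  let Q : F →ₗ[ℂ] V := (V.orthogonalProjectionOnto : E →ₗ[ℂ] V) ∘ₗ F.subtype
  have hQd : DenseRange Q := by
    have h1 : DenseRange (V.orthogonalProjectionOnto : E → V) :=
      Function.Surjective.denseRange fun v => ⟨v, by simp⟩
    exact h1.comp (hF.denseRange_val) V.orthogonalProjectionOnto.continuous
  have hQ : LinearMap.range Q = ⊤ := by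
    have hc : IsClosed ((LinearMap.range Q : Submodule ℂ V) : Set V) :=
      Submodule.closed_of_finiteDimensional _
    rw [← SetLike.coe_set_eq, ← hc.closure_eq]
    simpa only [LinearMap.coe_range, Submodule.top_coe] using hQd.closure_eq
  obtain ⟨s, hs⟩ := Q.exists_rightInverse_of_surjective hQ
  let s' : V →L[ℂ] E := LinearMap.toContinuousLinearMap (F.subtype ∘ₗ s)
  have hs' : ∀ v, V.orthogonalProjectionOnto (s' v) = v := fun v =>
    congrArg (fun l : V →ₗ[ℂ] V => l v) hs
  refine ⟨1 - s' ∘L V.orthogonalProjectionOnto, fun x hx => ?_, fun x hx => ⟨?_, ?_⟩⟩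
  · have : V.orthogonalProjectionOnto x = 0 := by
      rwa [Submodule.orthogonalProjectionOnto_eq_zero_iff]
    simp [this]
  · exact F.sub_mem hx (s _).2
  · rw [← Submodule.orthogonalProjectionOnto_eq_zero_iff]
    simp [hs']

theorem inner_eq_zero_of_block_eq_zero (e : HilbertBasis ℕ ℂ E) {X : E →L[ℂ] E} {a b i j : ℕ}
    (hX : (canonicalProj e b - canonicalProj e a) * X *
      (canonicalProj e b - canonicalProj e a) = 0)
    (hai : a ≤ i) (hib : i < b) (haj : a ≤ j) (hjb : j < b) :
    inner ℂ (e i) (X (e j)) = 0 := by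
  have h := congrArg (fun A : E →L[ℂ] E => inner ℂ (e i) (A (e j))) hX
  simpa [canonicalProj_apply_basis, inner_sub_right, inner_canonicalProj, hib, hjb,
    hai.not_gt, haj.not_gt] using h

theorem exists_mem_orthogonal_of_le_norm_sub_compact {X : E →L[ℂ] E} {c : ℝ} (hc : 0 < c)
    (hX : ∀ K : E →L[ℂ] E, IsCompactOperator K → c ≤ ‖X - K‖) {F : Submodule ℂ E}
    (hF : Dense (F : Set E)) (V : Submodule ℂ E) [FiniteDimensional ℂ V] :
    ∃ x ∈ F, x ∈ Vᗮ ∧ c / 2 * ‖x‖ < ‖X x‖ := by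
  have hcomp : IsCompactOperator (X * V.starProjection) := by
    have : ProperSpace V := FiniteDimensional.proper_rclike ℂ V
    have : IsCompactOperator (V.orthogonalProjectionOnto : E →L[ℂ] V) :=
      isCompactOperator_of_locallyCompactSpace_dom V.orthogonalProjectionOnto
    exact this.clm_comp (X ∘L V.subtypeL)
  obtain ⟨z, hz⟩ : ∃ z, c / 2 * ‖z‖ < ‖(X - X * V.starProjection) z‖ := by
    by_contra! hcon
    have := ContinuousLinearMap.opNorm_le_bound _ (by positivity) hcon
    linarith [hX _ hcomp]
  obtain ⟨R, hRV, hRF⟩ := exists_clm_fixing_orthogonal F V hF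
  have hw : z - V.starProjection z ∈ Vᗮ := V.sub_starProjection_mem_orthogonal z
  have hnorm : ‖z - V.starProjection z‖ ≤ ‖z‖ := by
    rw [← Submodule.starProjection_orthogonal_val]
    exact Submodule.norm_starProjection_apply_le _ _
  have hopen : IsOpen {y : E | c / 2 * ‖R y‖ < ‖X (R y)‖} :=
    isOpen_lt (by fun_prop) (by fun_prop)
  obtain ⟨y, hy, hyF⟩ := hF.inter_open_nonempty _ hopen ⟨z - V.starProjection z, by
    rw [Set.mem_ofPred_eq, hRV _ hw]
    refine lt_of_le_of_lt (by gcongr) (hz.trans_eq ?_)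
    simp⟩
  exact ⟨R y, (hRF y hyF).1, (hRF y hyF).2, hy⟩

variable [CompleteSpace E]

theorem inner_apply_eq_zero_of_entries (e : HilbertBasis ℕ ℂ E) (A : E →L[ℂ] E) (v x : E)
    (h : ∀ j, inner ℂ v (A (e j)) = 0 ∨ inner ℂ (e j) x = 0) : inner ℂ v (A x) = 0 := by
  rw [← ContinuousLinearMap.adjoint_inner_left]
  refine (e.hasSum_inner_mul_inner _ _).unique ?_
  convert! hasSum_zero with j
  rw [ContinuousLinearMap.adjoint_inner_left]
  exact mul_eq_zero.2 (h j)

theorem clm_eq_of_entries (e : HilbertBasis ℕ ℂ E) {A B : E →L[ℂ] E}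
    (h : ∀ i j, inner ℂ (e i) (A (e j)) = inner ℂ (e i) (B (e j))) : A = B := by
  ext x
  rw [← sub_eq_zero]
  refine e.eq_zero_of_inner_eq_zero fun i => ?_
  refine inner_apply_eq_zero_of_entries e (A - B) _ _ fun j => .inl ?_
  rw [sub_apply, inner_sub_right, h, sub_self]

theorem mem_nestAlgebra_iff (e : HilbertBasis ℕ ℂ E) {𝒩 : Nest E}
    (h𝒩 : 𝒩.carrier = {P | (∃ n : ℕ, P = canonicalProj e n) ∨ P = 1}) {X : E →L[ℂ] E} :
    X ∈ nestAlgebra 𝒩 ↔ ∀ i j, j < i → inner ℂ (e i) (X (e j)) = 0 := by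
  constructor
  · intro hX i j hij
    have hmem : canonicalProj e (j + 1) ∈ 𝒩.carrier := by rw [h𝒩]; exact .inl ⟨_, rfl⟩
    have h := congrArg (fun A : E →L[ℂ] E => inner ℂ (e i) (A (e j))) (hX _ hmem)
    simpa [canonicalProj_apply_basis, inner_sub_right, inner_canonicalProj,
      show ¬ i < j + 1 by omega] using h
  · intro hX Q hQ
    rw [h𝒩] at hQ
    obtain ⟨n, rfl⟩ | rfl := hQ
    · refine clm_eq_of_entries e fun i j => ?_
      simp only [mul_apply_eq_comp, canonicalProj_apply_basis,
        sub_apply, one_apply_eq_self, inner_sub_right,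
        inner_canonicalProj, zero_apply, inner_zero_right]
      split_ifs with hj hi
      · exact sub_self _
      · rw [sub_zero, hX i j (by omega)]
      · simp
      · simp
    · simp

theorem exists_clm_apply_basis_eq (e : HilbertBasis ℕ ℂ E) {f : ℕ → E} {C : ℝ}
    (hf : Pairwise fun i j => inner ℂ (f i) (f j) = 0) (hC : ∀ i, ‖f i‖ ≤ C) :
    ∃ J : E →L[ℂ] E, ∀ i, J (e i) = f i := by
  have hV : OrthogonalFamily ℂ (fun i => (ℂ ∙ f i)) fun i => (ℂ ∙ f i).subtypeₗᵢ := by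
    rw [orthogonalFamily_iff_pairwise]
    intro i j hij
    rw [Function.onFun, Submodule.isOrtho_span]
    rintro _ rfl _ rfl
    exact hf hij
  have hsum : ∀ x : E, Summable fun i => (inner ℂ (e i) x : ℂ) • f i := by
    intro x
    refine (hV.summable_iff_norm_sq_summable fun i =>
      ⟨(inner ℂ (e i) x : ℂ) • f i,
        Submodule.smul_mem _ _ (Submodule.mem_span_singleton_self _)⟩).2 ?_
    refine Summable.of_nonneg_of_le (fun i => by positivity) (fun i => ?_)
      ((e.orthonormal.inner_products_summable x).mul_right (C ^ 2))
    simp only [Submodule.coe_norm, norm_smul, mul_pow]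
    gcongr
    exact hC i
  have hlim : Tendsto (fun (n : ℕ) (x : E) =>
      (∑ i ∈ Finset.range n, (innerSL ℂ (e i)).smulRight (f i) : E →L[ℂ] E) x) atTop
      (𝓝 fun x => ∑' i, (inner ℂ (e i) x : ℂ) • f i) := by
    rw [tendsto_pi_nhds]
    intro x
    simpa using (hsum x).hasSum.tendsto_sum_nat
  refine ⟨continuousLinearMapOfTendsto _ hlim, fun i => ?_⟩
  change ∑' j, (inner ℂ (e j) (e i) : ℂ) • f j = f i
  rw [tsum_eq_single i]
  · simp [e.orthonormal.1 i]
  · intro j hj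
    simp [e.inner_eq_ite, hj]

theorem exists_pos_forall_le_norm_sub_compact {X : E →L[ℂ] E} (hX : ¬ IsCompactOperator X) :
    ∃ c : ℝ, 0 < c ∧ ∀ K : E →L[ℂ] E, IsCompactOperator K → c ≤ ‖X - K‖ := by
  have hcl : IsClosed {K : E →L[ℂ] E | IsCompactOperator K} :=
    isClosed_setOfPred_isCompactOperator
  obtain ⟨c, hc, hball⟩ := Metric.isOpen_iff.1 hcl.isOpen_compl X hX
  refine ⟨c, hc, fun K hK => ?_⟩
  by_contra! hlt
  exact hball (show K ∈ Metric.ball X c by rwa [Metric.mem_ball, dist_comm, dist_eq_norm]) hK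

theorem exists_finitely_supported_vector (e : HilbertBasis ℕ ℂ E) {X : E →L[ℂ] E}
    (hX : ¬ IsCompactOperator X) :
    ∃ C : ℝ, ∀ n : ℕ, ∃ m x, n < m ∧ (∀ i < n, inner ℂ (e i) x = 0) ∧
      (∀ i, m ≤ i → inner ℂ (e i) x = 0) ∧ (∀ i < n, inner ℂ (e i) (X x) = 0) ∧
      ‖X x‖ = 1 ∧ ‖x‖ ≤ C := by
  obtain ⟨c, hc, hcX⟩ := exists_pos_forall_le_norm_sub_compact hX
  have hF : Dense (Submodule.span ℂ (Set.range e) : Set E) := by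
    rw [Submodule.dense_iff_topologicalClosure_eq_top]
    exact e.dense_span
  refine ⟨(c / 2)⁻¹, fun n => ?_⟩
  let S : Set E := (fun i => e i) '' Set.Iio n ∪ (fun i => X.adjoint (e i)) '' Set.Iio n
  have hS : S.Finite := ((Set.finite_Iio n).image _).union ((Set.finite_Iio n).image _)
  have : FiniteDimensional ℂ (Submodule.span ℂ S) := FiniteDimensional.span_of_finite ℂ hS
  obtain ⟨x, hxF, hxV, hx⟩ :=
    exists_mem_orthogonal_of_le_norm_sub_compact hc hcX hF (Submodule.span ℂ S)
  obtain ⟨m, hm⟩ := exists_forall_inner_eq_zero_of_mem_span e hxF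
  have hpos : 0 < ‖X x‖ := lt_of_le_of_lt (by positivity) hx
  have hxS : ∀ s ∈ S, inner ℂ s x = 0 := fun s hs =>
    (Submodule.mem_orthogonal _ _).1 hxV s (Submodule.subset_span hs)
  refine ⟨max m (n + 1), ((‖X x‖⁻¹ : ℝ) : ℂ) • x, by omega, fun i hi => ?_, fun i hi => ?_,
    fun i hi => ?_, ?_, ?_⟩
  · rw [inner_smul_right, hxS _ (.inl ⟨i, hi, rfl⟩), mul_zero]
  · rw [inner_smul_right, hm i (le_of_max_le_left hi), mul_zero]
  · rw [map_smul, inner_smul_right, ← ContinuousLinearMap.adjoint_inner_left,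
      hxS _ (.inr ⟨i, hi, rfl⟩), mul_zero]
  · rw [map_smul, norm_smul, Complex.norm_real, norm_inv, norm_norm, inv_mul_cancel₀ hpos.ne']
  · rw [norm_smul, Complex.norm_real, norm_inv, norm_norm, inv_mul_le_iff₀ hpos,
      ← div_eq_mul_inv, le_div_iff₀ (by positivity)]
    linarith

/-- If `X` is triangular and not compact, then every operator supported far enough above the
diagonal factors through `X` inside the algebra of triangular operators. -/
theorem exists_factorization_of_not_compact (e : HilbertBasis ℕ ℂ E) {X : E →L[ℂ] E}
    (hX : ¬ IsCompactOperator X) (htri : ∀ i j, j < i → inner ℂ (e i) (X (e j)) = 0) :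
    ∃ g : ℕ → ℕ, StrictMono g ∧ ∀ Z : E →L[ℂ] E,
      (∀ i q, q < g i → inner ℂ (e i) (Z (e q)) = 0) →
      ∃ A B : E →L[ℂ] E, (∀ i j, j < i → inner ℂ (e i) (A (e j)) = 0) ∧
        (∀ i j, j < i → inner ℂ (e i) (B (e j)) = 0) ∧ Z = A * X * B := by
  obtain ⟨C, hC⟩ := exists_finitely_supported_vector e hX
  choose m x hm hlow hhigh hXlow hXn hxC using hC
  let n : ℕ → ℕ := fun k => m^[k] 0
  have hn : ∀ k, n (k + 1) = m (n k) := fun k => Function.iterate_succ_apply' m k 0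
  have hmono : StrictMono n := strictMono_nat_of_lt_succ fun k => by rw [hn]; exact hm _
  have hXhigh : ∀ k i, n (k + 1) ≤ i → inner ℂ (e i) (X (x (n k))) = 0 := by
    intro k i hi
    refine inner_apply_eq_zero_of_entries e X _ _ fun j => ?_
    by_cases hj : j < i
    · exact .inl (htri i j hj)
    · exact .inr (hhigh _ _ (by rw [← hn]; omega))
  have horth : ∀ u : ℕ → E, (∀ k, ∀ i < n k, inner ℂ (e i) (u k) = 0) →
      (∀ k i, n (k + 1) ≤ i → inner ℂ (e i) (u k) = 0) →
      Pairwise fun k l => inner ℂ (u k) (u l) = 0 := by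
    intro u hu hu' k l hkl
    refine (e.hasSum_inner_mul_inner _ _).unique ?_
    convert! hasSum_zero with i
    by_contra hne
    obtain ⟨hk, hl⟩ := mul_ne_zero_iff.1 hne
    rw [Ne, inner_eq_zero_symm] at hk
    have h1 : n k ≤ i := not_lt.1 fun h => hk (hu k i h)
    have h2 : i < n (k + 1) := not_le.1 fun h => hk (hu' k i h)
    have h3 : n l ≤ i := not_lt.1 fun h => hl (hu l i h)
    have h4 : i < n (l + 1) := not_le.1 fun h => hl (hu' l i h)
    obtain h | h := lt_or_gt_of_ne hkl
    · have := hmono.monotone (show k + 1 ≤ l from h)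
      omega
    · have := hmono.monotone (show l + 1 ≤ k from h)
      omega
  obtain ⟨J, hJ⟩ := exists_clm_apply_basis_eq e (f := fun k => x (n k))
    (horth _ (fun k => hlow _) fun k i hi => hhigh _ _ (by rwa [← hn])) fun k => hxC _
  have hXorth := horth (fun k => X (x (n k))) (fun k => hXlow _) hXhigh
  have hone : (X * J).adjoint * (X * J) = 1 := by
    refine clm_eq_of_entries e fun i j => ?_
    rw [mul_apply_eq_comp, ContinuousLinearMap.adjoint_inner_right]
    simp only [mul_apply_eq_comp, hJ, one_apply_eq_self, e.inner_eq_ite]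
    split_ifs with hij
    · subst hij
      rw [inner_self_eq_norm_sq_to_K, hXn]
      simp
    · exact hXorth hij
  refine ⟨fun i => n (i + 1), fun i j hij => hmono (by omega), fun Z hZ =>
    ⟨(X * J).adjoint, J * Z, fun i j hij => ?_, fun p q hpq => ?_, ?_⟩⟩
  · rw [ContinuousLinearMap.adjoint_inner_right, inner_eq_zero_symm]
    simp only [mul_apply_eq_comp, hJ]
    exact hXlow _ _ (hij.trans_le (hmono.id_le i))
  · rw [mul_apply_eq_comp]
    refine inner_apply_eq_zero_of_entries e J _ _ fun i => ?_
    by_cases hq : q < n (i + 1)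
    · exact .inr (hZ i q hq)
    · left
      rw [hJ]
      exact hhigh _ _ (by rw [← hn]; omega)
  · calc Z = (X * J).adjoint * (X * J) * Z := by rw [hone, one_mul]
      _ = _ := by simp only [mul_assoc]

/-- The diagonal projection onto the closed span of the basis vectors indexed by `S`. -/
theorem exists_diagonal_projection (e : HilbertBasis ℕ ℂ E) (S : Set ℕ) [DecidablePred (· ∈ S)] :
    ∃ D : E →L[ℂ] E, (∀ j, D (e j) = if j ∈ S then e j else 0) ∧
      ∀ i x, inner ℂ (e i) (D x) = if i ∈ S then inner ℂ (e i) x else 0 := by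
  obtain ⟨D, hD⟩ := exists_clm_apply_basis_eq e (f := fun j => if j ∈ S then e j else 0) (C := 1)
    (by
      intro i j hij
      split_ifs <;> simp [e.inner_eq_ite, hij])
    (by
      intro i
      split_ifs <;> simp [e.orthonormal.1 i])
  refine ⟨D, hD, fun i x => ?_⟩
  have hadj : D.adjoint (e i) = if i ∈ S then e i else 0 := by
    rw [← sub_eq_zero]
    refine e.eq_zero_of_inner_eq_zero fun j => ?_
    rw [inner_sub_right, ContinuousLinearMap.adjoint_inner_right, hD]
    by_cases hij : j = i
    · subst hij
      split_ifs <;> simp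
    · split_ifs <;> simp [e.inner_eq_ite, hij]
  rw [← ContinuousLinearMap.adjoint_inner_left, hadj]
  split_ifs <;> simp

theorem exists_between_of_strictMono {n : ℕ → ℕ} (hn : StrictMono n) (h0 : n 0 = 0) (i : ℕ) :
    ∃ k, n k ≤ i ∧ i < n (k + 1) := by
  classical
  have hex : ∃ k, i < n (k + 1) := ⟨i, hn.id_le (i + 1)⟩
  refine ⟨Nat.find hex, ?_, Nat.find_spec hex⟩
  rcases hk : Nat.find hex with _ | k
  · omega
  · exact not_lt.1 (Nat.find_min hex (by omega : k < Nat.find hex))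

theorem apply_lt_of_mem_separated_blocks {g n : ℕ → ℕ} (hg : StrictMono g) (hn : StrictMono n)
    (hgn : ∀ k, g (n k) < n (k + 1)) {i q k l : ℕ} (hik : i < n (4 * k + 1)) (hki : n (4 * k) ≤ i)
    (hlq : n (4 * l + 2) ≤ q) (hql : q < n (4 * l + 3)) (hiq : i ≤ q) : g i < q := by
  have h1 : 4 * k < 4 * l + 3 := hn.lt_iff_lt.1 (by omega)
  have h2 := hn.monotone (show 4 * k + 2 ≤ 4 * l + 2 by omega)
  have h3 := hg hik
  have h4 : g (n (4 * k + 1)) < n (4 * k + 2) := hgn (4 * k + 1)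
  omega

end Helpers

/-- let `𝒩` be the canonical nest `{N_n} ∪ {0, I}` on `ℓ²(ℕ)` (a
separable Hilbert space with orthonormal basis `e`), so `T(𝒩)` is the algebra of
upper-triangular operators, and let `P` be a primitive ideal of `T(𝒩)` strictly
containing the ideal `K` of compact upper-triangular operators. Then there is a
strictly increasing sequence `(n_k)` such that `P` contains the two-sided ideal of
all `X` with `(N_{n_{k+1}} - N_{n_k}) X (N_{n_{k+1}} - N_{n_k}) = 0` for all `k`. -/
theorem statement17 (e : HilbertBasis ℕ ℂ H) (𝒩 : Nest H)
    (h𝒩 : 𝒩.carrier = {P | (∃ n : ℕ, P = canonicalProj e n) ∨ P = 1})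
    (P : Set (nestAlgebra 𝒩)) (hP : IsLeftPrimitive (nestAlgebra 𝒩) P)
    (hK : {X : nestAlgebra 𝒩 | IsCompactOperator (X : H →L[ℂ] H)} ⊂ P) :
    ∃ n : ℕ → ℕ, StrictMono n ∧
      {X : nestAlgebra 𝒩 | ∀ k : ℕ,
          (canonicalProj e (n (k + 1)) - canonicalProj e (n k)) * (X : H →L[ℂ] H) *
            (canonicalProj e (n (k + 1)) - canonicalProj e (n k)) = 0} ⊆ P := by
  classical
  obtain ⟨L, hL, rfl⟩ := hP
  have htri := fun X : H →L[ℂ] H => mem_nestAlgebra_iff e h𝒩 (X := X)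
  obtain ⟨X, hXP, hXK⟩ := Set.not_subset.1 hK.2
  obtain ⟨g, hg, hfac⟩ := exists_factorization_of_not_compact e hXK ((htri _).1 X.2)
  have hfar : ∀ Z : nestAlgebra 𝒩,
      (∀ i q, q < g i → inner ℂ (e i) ((Z : H →L[ℂ] H) (e q)) = 0) → ∀ r, Z * r ∈ L := by
    intro Z hZ r
    obtain ⟨A, B, hA, hB, hZAB⟩ := hfac Z hZ
    have hZ' : Z = ⟨A, (htri A).2 hA⟩ * X * ⟨B, (htri B).2 hB⟩ := Subtype.ext hZAB
    rw [hZ', mul_assoc, mul_assoc]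
    exact L.mul_mem_left _ (hXP _)
  let n : ℕ → ℕ := fun k => (fun a => g a + 1)^[k] 0
  have hgn : ∀ k, g (n k) < n (k + 1) := fun k => by
    simp only [n, Function.iterate_succ_apply']
    exact Nat.lt_succ_self _
  have hn : StrictMono n := strictMono_nat_of_lt_succ fun k => (hg.id_le _).trans_lt (hgn k)
  let S : ℕ → Set ℕ := fun r => {i | ∃ k, n (4 * k + r) ≤ i ∧ i < n (4 * k + r + 1)}
  choose D hDe hDi using fun r => exists_diagonal_projection e (S r)
  have hDT : ∀ r, D r ∈ nestAlgebra 𝒩 := fun r => (htri _).2 fun i j hij => by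
    rw [hDi, e.inner_eq_ite, if_neg hij.ne', ite_self]
  let D' : ℕ → nestAlgebra 𝒩 := fun r => ⟨D r, hDT r⟩
  -- Once one of the diagonal projections lies in the ideal, only the corner of an operator
  -- complementary to it matters, and that corner is supported far above the diagonal.
  have key : ∀ (r : ℕ) (σ : ℕ → ℕ), StrictMono σ → σ 0 = 0 →
      (∀ k, ∃ l, σ (k + 1) = 4 * l + r) → (∀ t, D' r * t ∈ L) →
      ∃ n : ℕ → ℕ, StrictMono n ∧
        {X : nestAlgebra 𝒩 | ∀ k : ℕ,
          (canonicalProj e (n (k + 1)) - canonicalProj e (n k)) * (X : H →L[ℂ] H) *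
            (canonicalProj e (n (k + 1)) - canonicalProj e (n k)) = 0} ⊆
        {x | ∀ t, x * t ∈ L} := by
    intro r σ hσ hσ0 hσr hD
    refine ⟨n ∘ σ, hn.comp hσ, fun Y hY t => ?_⟩
    have hsplit : Y * t = D' r * (Y * t) + (1 - D' r) * Y * (D' r * t) +
        (1 - D' r) * Y * (1 - D' r) * t := by
      simp only [sub_mul, mul_sub, one_mul, mul_one, mul_assoc]
      abel
    rw [hsplit]
    refine L.add_mem (L.add_mem (hD _) (L.mul_mem_left _ (hD _))) (hfar _ (fun i q hq => ?_) t)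
    have hentry : inner ℂ (e i) (((1 - D' r) * Y * (1 - D' r) : nestAlgebra 𝒩).1 (e q)) =
        if i ∈ S r ∨ q ∈ S r then 0 else inner ℂ (e i) (Y.1 (e q)) := by
      change inner ℂ (e i) (Y.1 (e q - D r (e q)) - D r (Y.1 (e q - D r (e q)))) = _
      rw [inner_sub_right, hDi, hDe]
      by_cases hi : i ∈ S r <;> by_cases hq : q ∈ S r <;> simp [hi, hq]
    refine hentry.trans ?_
    split_ifs with hS
    · rfl
    obtain ⟨hiS, hqS⟩ := not_or.1 hS
    obtain hqi | hiq := lt_or_ge q i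
    · exact (htri _).1 Y.2 i q hqi
    obtain ⟨k, hki, hik⟩ := exists_between_of_strictMono (hn.comp hσ)
      (show n (σ 0) = 0 by rw [hσ0]; rfl) i
    obtain hqk | hkq := lt_or_ge q ((n ∘ σ) (k + 1))
    · exact inner_eq_zero_of_block_eq_zero e (hY k) hki hik (hki.trans hiq) hqk
    · exfalso
      obtain ⟨l, hl⟩ := hσr k
      simp only [Function.comp_apply, hl] at hik hkq
      have h1 : n (4 * l + r + 1) ≤ q := not_lt.1 fun h => hqS ⟨l, hkq, h⟩
      have h2 := hgn (4 * l + r)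
      have h3 := hg hik
      omega
  have hprime : ∀ t s, D' 0 * t * D' 2 * s ∈ L := fun t => hfar _ fun i q hq => by
    change inner ℂ (e i) (D 0 (t.1 (D 2 (e q)))) = 0
    rw [hDi, hDe]
    split_ifs with hi hq'
    · obtain ⟨k, hk, hk'⟩ := hi
      obtain ⟨l, hl, hl'⟩ := hq'
      refine (htri _).1 t.2 i q (not_le.1 fun hiq => ?_)
      exact (apply_lt_of_mem_separated_blocks hg hn hgn hk' hk hl hl' hiq).not_gt hq
    · simp
    · rfl
  obtain h | h := mem_or_mem_of_forall_mul_mul_mem hL hprime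
  · exact key 0 (fun k => 4 * k) (fun a b hab => by dsimp only; omega) rfl
      (fun k => ⟨k + 1, rfl⟩) h
  · exact key 2 (fun k => 4 * k - 2) (fun a b hab => by dsimp only; omega) rfl
      (fun k => ⟨k, by omega⟩) h
end
end
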